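/- Let a: V×V→ℂ be a bounded coercive form with constants K, κ, A the associated operator, and (A_m) the Galerkin space discretization of A with respect to an approximating sequence (V_m) of V. Let s > 0 and p₁, p₂ ≥ 0 be such that γ_m(dom(A^s)) ≤ C_γ/m^{p₁} and γ_m^*(H) ≤ C*_γ/m^{p₂} for all m ∈ ℕ. Then for all u₀ ∈ dom(A^s) and m ∈ ℕ: ‖J_m A_m^{-1} P_m u₀ − A^{-1} u₀‖_H ≤ (K²/κ) C_γ C*_γ ‖u₀‖_{A^s} / m^{p₁+p₂}. In particular, if p₁+p₂ > 0, the space discretization converges of order p₁+p₂ on dom(A^s) for the stationary problem. -/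

import Mathlib

noncomputable section

open scoped ComplexConjugate InnerProductSpace

/-- The (possibly unbounded) operator `A` in `H` associated with the sesquilinear form `a` on
`V`, with respect to the continuous dense embedding `ι : V → H`:
`dom(A) = {u ∈ V : ∃ f ∈ H ∀ v ∈ V, a(u,v) = ⟨f,v⟩_H}`, `Au = f`.
(The inner product `⟪ι v, f⟫_ℂ` is conjugate-linear in `ι v`, matching the fact that
`a(u,v)` is conjugate-linear in `v`.) -/
structure IsAssociatedOperator {V H : Type*}
    [NormedAddCommGroup V] [InnerProductSpace ℂ V]
    [NormedAddCommGroup H] [InnerProductSpace ℂ H]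
    (ι : V →L[ℂ] H) (a : V → V → ℂ) (A : H →ₗ.[ℂ] H) : Prop where
  mem_domain_iff : ∀ u : H, u ∈ A.domain ↔
    ∃ uV : V, ι uV = u ∧ ∃ f : H, ∀ v : V, a uV v = ⟪ι v, f⟫_ℂ
  apply_eq : ∀ (u : A.domain) (uV : V), ι uV = (u : H) →
    ∀ v : V, a uV v = ⟪ι v, (A u : H)⟫_ℂ

set_option maxHeartbeats 1000000 in
/-- Lax-Milgram for the adjoint problem. -/
theorem exists_adjoint_solution {V H : Type*}
    [NormedAddCommGroup V] [InnerProductSpace ℂ V] [CompleteSpace V]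
    [NormedAddCommGroup H] [InnerProductSpace ℂ H]
    (ι : V →L[ℂ] H) (a : V → V → ℂ)
    (ha₁ : ∀ (c : ℂ) (u u' v : V), a (c • u + u') v = c * a u v + a u' v)
    (ha₂ : ∀ (c : ℂ) (u v v' : V), a u (c • v + v') = conj c * a u v + a u v')
    (K κ : ℝ) (hκ : 0 < κ)
    (hbdd : ∀ u v : V, ‖a u v‖ ≤ K * ‖u‖ * ‖v‖)
    (hcoer : ∀ u : V, κ * ‖u‖ ^ 2 ≤ (a u u).re) (f : H) :
    ∃ w : V, ∀ v : V, conj (a v w) = ⟪ι v, f⟫_ℂ := by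
  have z1 : ∀ v, a 0 v = 0 := fun v => by
    have := ha₁ 1 0 0 v
    simpa using this
  have z2 : ∀ v, a v 0 = 0 := fun v => by
    have := ha₂ 1 v 0 0
    simpa using this
  have add1 : ∀ u u' v, a (u + u') v = a u v + a u' v := fun u u' v => by
    simpa using ha₁ 1 u u' v
  have add2 : ∀ u v v', a u (v + v') = a u v + a u v' := fun u v v' => by
    simpa using ha₂ 1 u v v'
  have sm1 : ∀ (c : ℂ) u v, a (c • u) v = c * a u v := fun c u v => by
    simpa [z1] using ha₁ c u 0 v
  have sm2 : ∀ (c : ℂ) u v, a u (c • v) = conj c * a u v := fun c u v => by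
    simpa [z2] using ha₂ c u v 0
  letI : InnerProductSpace ℝ V := InnerProductSpace.complexToReal
  let B₀ : V →ₗ[ℝ] V →ₗ[ℝ] ℝ := LinearMap.mk₂ ℝ (fun u v => (a v u).re)
    (fun u u' v => by simp [add2])
    (fun c u v => by
      have := sm2 (c : ℂ) v u
      rw [Complex.coe_smul] at this
      simp [this])
    (fun u v v' => by simp [add1])
    (fun c u v => by
      have := sm1 (c : ℂ) v u
      rw [Complex.coe_smul] at this
      simp [this])
  let B : V →L[ℝ] V →L[ℝ] ℝ := B₀.mkContinuous₂ K (fun u v => by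
    have h1 := hbdd v u
    have h2 := Complex.abs_re_le_norm (a v u)
    change |(a v u).re| ≤ _
    nlinarith)
  have hB : ∀ u v, B u v = (a v u).re := fun u v => rfl
  have hco : IsCoercive B := ⟨κ, hκ, fun u => by
    rw [hB]; have := hcoer u; nlinarith⟩
  let L : V →L[ℝ] ℝ := Complex.reCLM.comp (((innerSL ℂ f).comp ι).restrictScalars ℝ)
  have hL : ∀ v, L v = (⟪f, ι v⟫_ℂ).re := fun v => rfl
  obtain ⟨w, hw⟩ := hco.continuousLinearEquivOfBilin.surjective
    ((InnerProductSpace.toDual ℝ V).symm L)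
  have key : ∀ v, (a v w).re = (⟪f, ι v⟫_ℂ).re := fun v => by
    have h := hco.continuousLinearEquivOfBilin_apply w v
    rw [hw, hB, InnerProductSpace.toDual_symm_apply, hL] at h
    exact h.symm
  refine ⟨w, fun v => ?_⟩
  rw [← inner_conj_symm]
  congr 1
  apply Complex.ext
  · exact key v
  · have := key (Complex.I • v)
    rw [sm1, map_smul, inner_smul_right] at this
    simpa using this

/-- Theorem on convergence of the Galerkin discretization for the stationary
problem.  `V, H` separable complex Hilbert spaces, `ι : V ↪ H` continuous dense embedding,
`a` a bounded coercive sesquilinear form with constants `K, κ`, `A` the associated operator,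
`As` the fractional power `A^s` (`s > 0`) with graph norm `u ↦ √(‖u‖² + ‖A^s u‖²)`,
`(Vm m)` an approximating sequence of closed subspaces of `V`, `P m` the `H`-orthogonal
projection onto `H_m = closure (ι '' Vm m)`.  The quantities `γ_m(dom A^s)` and `γ_m^*(H)`
are assumed to decay like `C_γ/m^{p₁}` and `C*_γ/m^{p₂}` (stated, equivalently via
homogeneity, as bounds on the distance of variational solutions to `Vm m`).  Then for
`u₀ ∈ dom(A^s)`, with `u` the solution of `a(u,v) = ⟨u₀,v⟩` and `um ∈ Vm m` the Galerkin
solution of `a(um,v) = ⟨P_m u₀, v⟩` for `v ∈ Vm m` (so that `ι um = J_m A_m^{-1} P_m u₀` and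
`ι u = A^{-1} u₀`), one has
`‖J_m A_m^{-1} P_m u₀ − A^{-1} u₀‖_H ≤ (K²/κ) C_γ C*_γ ‖u₀‖_{A^s} / m^{p₁+p₂}`. -/
theorem stmt1
    {V H : Type*}
    [NormedAddCommGroup V] [InnerProductSpace ℂ V] [CompleteSpace V]
    [SecondCountableTopology V]
    [NormedAddCommGroup H] [InnerProductSpace ℂ H] [CompleteSpace H]
    [SecondCountableTopology H]
    (ι : V →L[ℂ] H) (hι_inj : Function.Injective ι) (hι_dense : DenseRange ι)
    -- the form `a`, sesquilinear: linear in the first, conjugate-linear in the second variable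
    (a : V → V → ℂ)
    (ha₁ : ∀ (c : ℂ) (u u' v : V), a (c • u + u') v = c * a u v + a u' v)
    (ha₂ : ∀ (c : ℂ) (u v v' : V), a u (c • v + v') = conj c * a u v + a u v')
    -- bounded with constant `K`, coercive with constant `κ`
    (K κ : ℝ) (hκ : 0 < κ)
    (hbdd : ∀ u v : V, ‖a u v‖ ≤ K * ‖u‖ * ‖v‖)
    (hcoer : ∀ u : V, κ * ‖u‖ ^ 2 ≤ (a u u).re)
    -- the associated operator `A` and the fractional power `As = A^s`, `s > 0`
    (A : H →ₗ.[ℂ] H) (hA : IsAssociatedOperator ι a A)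
    (s : ℝ) (hs : 0 < s) (As : H →ₗ.[ℂ] H)
    -- approximating sequence `(Vm m)` of `V`
    (Vm : ℕ → Submodule ℂ V) (hVmclosed : ∀ m, IsClosed (Vm m : Set V))
    (hVmapprox : ∀ v : V,
      Filter.Tendsto (fun m => Metric.infDist v (Vm m : Set V)) Filter.atTop (nhds 0))
    -- the `H`-orthogonal projections `P m` onto `H_m = closure (ι '' Vm m)`
    (P : ℕ → H →L[ℂ] H)
    (hPmem : ∀ m (u : H), P m u ∈ closure (ι '' (Vm m : Set V)))
    (hPorth : ∀ m (u w : H), w ∈ closure (ι '' (Vm m : Set V)) → ⟪u - P m u, w⟫_ℂ = 0)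
    -- decay of `γ_m(dom(A^s))` with rate `p₁` and constant `Cγ`
    (p₁ p₂ Cγ Cγs : ℝ) (hp₁ : 0 ≤ p₁) (hp₂ : 0 ≤ p₂) (hCγ : 0 ≤ Cγ) (hCγs : 0 ≤ Cγs)
    (hgamma : ∀ m : ℕ, 1 ≤ m → ∀ (u₀ : As.domain) (u : V),
      (∀ v : V, a u v = ⟪ι v, (u₀ : H)⟫_ℂ) →
      Metric.infDist u (Vm m : Set V) ≤
        Cγ / (m : ℝ) ^ p₁ * Real.sqrt (‖(u₀ : H)‖ ^ 2 + ‖As u₀‖ ^ 2))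
    -- decay of `γ_m^*(H)` with rate `p₂` and constant `C*γ`
    (hgammastar : ∀ m : ℕ, 1 ≤ m → ∀ (f : H) (u : V),
      (∀ v : V, conj (a v u) = ⟪ι v, f⟫_ℂ) →
      Metric.infDist u (Vm m : Set V) ≤ Cγs / (m : ℝ) ^ p₂ * ‖f‖) :
    -- conclusion: the quantified error bound for the stationary problem
    ∀ m : ℕ, 1 ≤ m → ∀ (u₀ : As.domain) (um u : V),
      um ∈ Vm m →
      (∀ v : V, v ∈ Vm m → a um v = ⟪ι v, P m (u₀ : H)⟫_ℂ) →
      (∀ v : V, a u v = ⟪ι v, (u₀ : H)⟫_ℂ) →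
      ‖ι um - ι u‖ ≤
        K ^ 2 / κ * Cγ * Cγs * Real.sqrt (‖(u₀ : H)‖ ^ 2 + ‖As u₀‖ ^ 2) /
          (m : ℝ) ^ (p₁ + p₂) := by
  intro m hm u₀ um u hum hGal hu
  have sub1 : ∀ u u' v, a (u - u') v = a u v - a u' v := fun u u' v => by
    have := ha₁ (-1) u' u v
    rw [show u - u' = (-1 : ℂ) • u' + u by rw [neg_one_smul]; abel, this]; ring
  have sub2 : ∀ u v v', a u (v - v') = a u v - a u v' := fun u v v' => by
    have := ha₂ (-1) u v' v
    rw [show v - v' = (-1 : ℂ) • v' + v by rw [neg_one_smul]; abel, this]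
    simp; ring
  set R := Real.sqrt (‖(u₀ : H)‖ ^ 2 + ‖As u₀‖ ^ 2) with hR
  have hR0 : 0 ≤ R := Real.sqrt_nonneg _
  have hmpos : (0 : ℝ) < m := by exact_mod_cast hm
  have hm1 : 0 < (m : ℝ) ^ p₁ := Real.rpow_pos_of_pos hmpos _
  have hm2 : 0 < (m : ℝ) ^ p₂ := Real.rpow_pos_of_pos hmpos _
  have hne : (Vm m : Set V).Nonempty := ⟨0, (Vm m).zero_mem⟩
  rw [← map_sub]
  set e := um - u with he
  have hrhs : 0 ≤ K ^ 2 / κ * Cγ * Cγs * R / (m : ℝ) ^ (p₁ + p₂) := by positivity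
  by_cases he0 : e = 0
  · simpa [he0] using hrhs
  have hen : 0 < ‖e‖ := norm_pos_iff.mpr he0
  have hK : 0 < K := by
    have h1 := hcoer e
    have h2 := hbdd e e
    have h3 := Complex.re_le_norm (a e e)
    have h4 : 0 < κ * ‖e‖ ^ 2 := by positivity
    by_contra hcon
    push Not at hcon
    nlinarith [mul_pos hen hen]
  -- Galerkin orthogonality
  have horth : ∀ v ∈ Vm m, a e v = 0 := fun v hv => by
    rw [he, sub1, hGal v hv, hu v, ← inner_sub_right, ← inner_conj_symm]
    have := hPorth m (u₀ : H) (ι v) (subset_closure ⟨v, hv, rfl⟩)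
    rw [← neg_sub, inner_neg_left, this]; simp
  -- Cea estimate
  have hcea : ‖e‖ ≤ K / κ * Metric.infDist u (Vm m : Set V) := by
    have : κ / K * ‖e‖ ≤ Metric.infDist u (Vm m : Set V) := by
      rw [Metric.le_infDist hne]
      intro v hv
      have h1 : a e e = a e (v - u) := by
        rw [show e = um - u from he, sub2, sub2, ← he, horth um hum, horth v hv]
      have h2 := hcoer e
      have h3 := hbdd e (v - u)
      have h4 := Complex.re_le_norm (a e e)
      rw [h1] at h2 h4
      rw [dist_comm, dist_eq_norm, div_mul_eq_mul_div, div_le_iff₀ hK]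
      have h5 : ‖e‖ * (κ * ‖e‖) ≤ ‖e‖ * (‖v - u‖ * K) := by nlinarith
      exact le_of_mul_le_mul_left h5 hen
    calc ‖e‖ = K / κ * (κ / K * ‖e‖) := by field_simp
      _ ≤ _ := by gcongr
  obtain ⟨w, hw⟩ := exists_adjoint_solution ι a ha₁ ha₂ K κ hκ hbdd hcoer (ι e)
  have hdual : ‖ι e‖ ^ 2 ≤ K * ‖e‖ * Metric.infDist w (Vm m : Set V) := by
    have : ‖ι e‖ ^ 2 / (K * ‖e‖) ≤ Metric.infDist w (Vm m : Set V) := by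
      rw [Metric.le_infDist hne]
      intro v hv
      have h1 := hw e
      rw [inner_self_eq_norm_sq_to_K] at h1
      have h2 : ‖a e w‖ = ‖ι e‖ ^ 2 := by
        rw [← RCLike.norm_conj, h1]; simp
      have h3 := hbdd e (w - v)
      rw [sub2, horth v hv, sub_zero, h2] at h3
      rw [dist_eq_norm, div_le_iff₀ (by positivity)]
      linarith
    rw [div_le_iff₀ (by positivity)] at this
    linarith
  have hg := hgamma m hm u₀ u hu
  have hgs := hgammastar m hm (ι e) w hw
  have hι : 0 < ‖ι e‖ := norm_pos_iff.mpr fun h => he0 (hι_inj (by rw [h, map_zero]))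
  have hfin : ‖ι e‖ * ‖ι e‖ ≤ ‖ι e‖ *
      (K * (K / κ * (Cγ / (m : ℝ) ^ p₁ * R)) * (Cγs / (m : ℝ) ^ p₂)) := by
    calc ‖ι e‖ * ‖ι e‖ = ‖ι e‖ ^ 2 := by ring
      _ ≤ K * ‖e‖ * Metric.infDist w (Vm m : Set V) := hdual
      _ ≤ K * (K / κ * (Cγ / (m : ℝ) ^ p₁ * R)) * (Cγs / (m : ℝ) ^ p₂ * ‖ι e‖) := by
        gcongr
        · exact Metric.infDist_nonneg
        · exact hcea.trans (by gcongr)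
      _ = _ := by ring
  refine (le_of_mul_le_mul_left hfin hι).trans (le_of_eq ?_)
  rw [Real.rpow_add hmpos]
  field_simp
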